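/- Let S = sgp⟨A | u = v⟩ be the one-relator monoid presented by A = {a_1,…,a_n} where u, v ∈ A^* with |u| = |v| = 2 and u ≠ v. Then S is biautomatic and prefix-automatic. -/

import Mathlib

/-!  Common definitions, following the conventions of the paper
"Automaticity of one-relator semigroups with length less than or equal to three".

Words over an alphabet `α` are modelled as `List α`; the empty word is `[]`.
The padded alphabet `A(2,$)` is modelled inside `Option α × Option α`,
where `none` plays the role of the padding symbol `$` (the pair `(none, none)`
never occurs in a padded convolution). -/

/-- A regular set of words: one accepted by a DFA with finitely many states. -/
abbrev IsReg {α : Type*} (L : Set (List α)) : Prop :=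
  Language.IsRegular (L : Language α)

/-- Right-padded convolution `(x,y)δᴿ`: align the two words letter by letter
from the left and pad the shorter one on the right with the padding symbol. -/
def padR {α : Type*} (x y : List α) : List (Option α × Option α) :=
  (x.map some ++ List.replicate (y.length - x.length) none).zip
    (y.map some ++ List.replicate (x.length - y.length) none)

/-- Left-padded convolution `(x,y)δᴸ`: align the two words letter by letter
from the right and pad the shorter one on the left with the padding symbol. -/
def padL {α : Type*} (x y : List α) : List (Option α × Option α) :=
  (List.replicate (y.length - x.length) none ++ x.map some).zip
    (List.replicate (x.length - y.length) none ++ y.map some)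

/-- One elementary rewriting step: replace a factor `u` by `v`
for some defining relation `(u, v) ∈ R` (in either direction via `Relation.EqvGen`). -/
def OneStep {α : Type*} (R : Set (List α × List α)) (x y : List α) : Prop :=
  ∃ p u v s, (u, v) ∈ R ∧ x = p ++ u ++ s ∧ y = p ++ v ++ s

/-- Equality of two words in the semigroup `sgp⁺⟨α ∣ R⟩` (resp. the monoid
`sgp⟨α ∣ R⟩`): the congruence on words generated by the relations `R`. -/
def WordEq {α : Type*} (R : Set (List α × List α)) : List α → List α → Prop :=
  Relation.EqvGen (OneStep R)

/-- Expansion of a word over an abstract generating set `β` into a word over the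
presentation alphabet `α`, where `g b` is a word representing the generator `b`. -/
def expandW {α β : Type*} (g : β → List α) (w : List β) : List α :=
  (w.map g).flatten

/-- `(g, L)` is an automatic structure for the semigroup `sgp⁺⟨α ∣ R⟩` with
respect to the finite generating set indexed by `β`:  each generator `b` is the
element of the semigroup represented by the nonempty word `g b`, the language
`L ⊆ β⁺` is regular and maps onto the semigroup, and `L_ε^$` together with all
`L_b^$` (right multiplication, right padding) are regular. -/
structure SgpAutoStruct {α β : Type*} (R : Set (List α × List α))
    (g : β → List α) (L : Set (List β)) : Prop where
  gen_ne : ∀ b, g b ≠ []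
  reg : IsReg L
  ne : ∀ w ∈ L, w ≠ []
  onto : ∀ w : List α, w ≠ [] → ∃ x ∈ L, WordEq R (expandW g x) w
  eq_reg : IsReg {p | ∃ x ∈ L, ∃ y ∈ L,
      WordEq R (expandW g x) (expandW g y) ∧ p = padR x y}
  mul_reg : ∀ b : β, IsReg {p | ∃ x ∈ L, ∃ y ∈ L,
      WordEq R (expandW g x ++ g b) (expandW g y) ∧ p = padR x y}

/-- A prefix-automatic structure for `sgp⁺⟨α ∣ R⟩`: an automatic structure for
which moreover `L'_= = {(x,y)δᴿ : x ∈ L, y ∈ Pref(L), x = y in S}` is regular. -/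
structure SgpPrefixAutoStruct {α β : Type*} (R : Set (List α × List α))
    (g : β → List α) (L : Set (List β)) extends SgpAutoStruct R g L : Prop where
  pre_reg : IsReg {p | ∃ x ∈ L, ∃ y : List β, (∃ z ∈ L, y <+: z) ∧
      WordEq R (expandW g x) (expandW g y) ∧ p = padR x y}

/-- A biautomatic structure for the semigroup `sgp⁺⟨α ∣ R⟩`: the languages
`L_b^$`, `_bL^$`, `^$L_b` and `_b^$L` are regular for every `b ∈ β ∪ {ε}`. -/
structure SgpBiautoStruct {α β : Type*} (R : Set (List α × List α))
    (g : β → List α) (L : Set (List β)) : Prop where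
  gen_ne : ∀ b, g b ≠ []
  reg : IsReg L
  ne : ∀ w ∈ L, w ≠ []
  onto : ∀ w : List α, w ≠ [] → ∃ x ∈ L, WordEq R (expandW g x) w
  eqR_reg : IsReg {p | ∃ x ∈ L, ∃ y ∈ L,
      WordEq R (expandW g x) (expandW g y) ∧ p = padR x y}
  eqL_reg : IsReg {p | ∃ x ∈ L, ∃ y ∈ L,
      WordEq R (expandW g x) (expandW g y) ∧ p = padL x y}
  mulRR_reg : ∀ b : β, IsReg {p | ∃ x ∈ L, ∃ y ∈ L,
      WordEq R (expandW g x ++ g b) (expandW g y) ∧ p = padR x y}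
  mulLR_reg : ∀ b : β, IsReg {p | ∃ x ∈ L, ∃ y ∈ L,
      WordEq R (g b ++ expandW g x) (expandW g y) ∧ p = padR x y}
  mulRL_reg : ∀ b : β, IsReg {p | ∃ x ∈ L, ∃ y ∈ L,
      WordEq R (expandW g x ++ g b) (expandW g y) ∧ p = padL x y}
  mulLL_reg : ∀ b : β, IsReg {p | ∃ x ∈ L, ∃ y ∈ L,
      WordEq R (g b ++ expandW g x) (expandW g y) ∧ p = padL x y}

/-- The semigroup `sgp⁺⟨α ∣ R⟩` is automatic: it admits an automatic structure
over some finite generating set. -/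
def SgpAutomatic {α : Type*} (R : Set (List α × List α)) : Prop :=
  ∃ (β : Type) (_ : Fintype β) (g : β → List α) (L : Set (List β)),
    SgpAutoStruct R g L

/-- The semigroup `sgp⁺⟨α ∣ R⟩` is prefix-automatic. -/
def SgpPrefixAutomatic {α : Type*} (R : Set (List α × List α)) : Prop :=
  ∃ (β : Type) (_ : Fintype β) (g : β → List α) (L : Set (List β)),
    SgpPrefixAutoStruct R g L

/-- The semigroup `sgp⁺⟨α ∣ R⟩` is biautomatic. -/
def SgpBiautomatic {α : Type*} (R : Set (List α × List α)) : Prop :=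
  ∃ (β : Type) (_ : Fintype β) (g : β → List α) (L : Set (List β)),
    SgpBiautoStruct R g L

/-- `(g, L)` is an automatic structure for the monoid `sgp⟨α ∣ R⟩` with respect
to a finite generating set indexed by `β`; generators may represent any element
of the monoid (in particular the identity, represented by the empty word). -/
structure MonAutoStruct {α β : Type*} (R : Set (List α × List α))
    (g : β → List α) (L : Set (List β)) : Prop where
  reg : IsReg L
  ne : ∀ w ∈ L, w ≠ []
  onto : ∀ w : List α, ∃ x ∈ L, WordEq R (expandW g x) w
  eq_reg : IsReg {p | ∃ x ∈ L, ∃ y ∈ L,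
      WordEq R (expandW g x) (expandW g y) ∧ p = padR x y}
  mul_reg : ∀ b : β, IsReg {p | ∃ x ∈ L, ∃ y ∈ L,
      WordEq R (expandW g x ++ g b) (expandW g y) ∧ p = padR x y}

/-- A prefix-automatic structure for the monoid `sgp⟨α ∣ R⟩`. -/
structure MonPrefixAutoStruct {α β : Type*} (R : Set (List α × List α))
    (g : β → List α) (L : Set (List β)) extends MonAutoStruct R g L : Prop where
  pre_reg : IsReg {p | ∃ x ∈ L, ∃ y : List β, (∃ z ∈ L, y <+: z) ∧
      WordEq R (expandW g x) (expandW g y) ∧ p = padR x y}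

/-- A biautomatic structure for the monoid `sgp⟨α ∣ R⟩`. -/
structure MonBiautoStruct {α β : Type*} (R : Set (List α × List α))
    (g : β → List α) (L : Set (List β)) : Prop where
  reg : IsReg L
  ne : ∀ w ∈ L, w ≠ []
  onto : ∀ w : List α, ∃ x ∈ L, WordEq R (expandW g x) w
  eqR_reg : IsReg {p | ∃ x ∈ L, ∃ y ∈ L,
      WordEq R (expandW g x) (expandW g y) ∧ p = padR x y}
  eqL_reg : IsReg {p | ∃ x ∈ L, ∃ y ∈ L,
      WordEq R (expandW g x) (expandW g y) ∧ p = padL x y}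
  mulRR_reg : ∀ b : β, IsReg {p | ∃ x ∈ L, ∃ y ∈ L,
      WordEq R (expandW g x ++ g b) (expandW g y) ∧ p = padR x y}
  mulLR_reg : ∀ b : β, IsReg {p | ∃ x ∈ L, ∃ y ∈ L,
      WordEq R (g b ++ expandW g x) (expandW g y) ∧ p = padR x y}
  mulRL_reg : ∀ b : β, IsReg {p | ∃ x ∈ L, ∃ y ∈ L,
      WordEq R (expandW g x ++ g b) (expandW g y) ∧ p = padL x y}
  mulLL_reg : ∀ b : β, IsReg {p | ∃ x ∈ L, ∃ y ∈ L,
      WordEq R (g b ++ expandW g x) (expandW g y) ∧ p = padL x y}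

/-- The monoid `sgp⟨α ∣ R⟩` is automatic. -/
def MonAutomatic {α : Type*} (R : Set (List α × List α)) : Prop :=
  ∃ (β : Type) (_ : Fintype β) (g : β → List α) (L : Set (List β)),
    MonAutoStruct R g L

/-- The monoid `sgp⟨α ∣ R⟩` is prefix-automatic. -/
def MonPrefixAutomatic {α : Type*} (R : Set (List α × List α)) : Prop :=
  ∃ (β : Type) (_ : Fintype β) (g : β → List α) (L : Set (List β)),
    MonPrefixAutoStruct R g L

/-- The monoid `sgp⟨α ∣ R⟩` is biautomatic. -/
def MonBiautomatic {α : Type*} (R : Set (List α × List α)) : Prop :=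
  ∃ (β : Type) (_ : Fintype β) (g : β → List α) (L : Set (List β)),
    MonBiautoStruct R g L

/-- The defining relations of `S¹ = sgp⁺⟨α, e ∣ R, ea = ae = a, ee = e⟩`,
the monoid obtained from `S = sgp⁺⟨α ∣ R⟩` by adjoining an identity element,
presented as a semigroup over the alphabet `Option α` where `none` is the new
identity letter `e`. -/
def adjoinOne {α : Type*} (R : Set (List α × List α)) :
    Set (List (Option α) × List (Option α)) :=
  {q | ∃ p ∈ R, q = (p.1.map some, p.2.map some)} ∪
    {q | ∃ a : α, q = ([none, some a], [some a])} ∪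
    {q | ∃ a : α, q = ([some a, none], [some a])} ∪
    {([none, none], [none])}

theorem crit {γ σ : Type} [Finite σ] (K : σ → Set (List γ))
    (h : ∀ s p, ∃ s', ∀ w, p :: w ∈ K s ↔ w ∈ K s') (s : σ) : IsReg (K s) := by
  classical
  choose st hst using h
  have := Fintype.ofFinite σ
  refine ⟨σ, inferInstance, ⟨st, s, {s | [] ∈ K s}⟩, ?_⟩
  have key : ∀ (w : List γ) (t : σ), DFA.evalFrom ⟨st, s, {s | [] ∈ K s}⟩ t w ∈ {s | [] ∈ K s} ↔ w ∈ K t := by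
    intro w
    induction w with
    | nil => intro t; simp
    | cons p w ih => intro t; rw [DFA.evalFrom_cons, ih, hst]
  ext w
  exact key w s

theorem mem_acceptsFrom_cons {γ σ : Type} (M : DFA γ σ) (q : σ) (p : γ) (w : List γ) :
    p :: w ∈ M.acceptsFrom q ↔ w ∈ M.acceptsFrom (M.step q p) := by
  simp [DFA.mem_acceptsFrom]

theorem isReg_empty {γ : Type} : IsReg (∅ : Set (List γ)) :=
  crit (fun _ : Unit => ∅) (fun _ _ => ⟨(), fun w => by simp⟩) ()

theorem isReg_union {γ : Type} {A B : Set (List γ)} (hA : IsReg A) (hB : IsReg B) : IsReg (A ∪ B) :=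
  Language.IsRegular.add hA hB

theorem isReg_inter {γ : Type} {A B : Set (List γ)} (hA : IsReg A) (hB : IsReg B) : IsReg (A ∩ B) :=
  Language.IsRegular.inf hA hB

theorem isReg_diff {γ : Type} {A B : Set (List γ)} (hA : IsReg A) (hB : IsReg B) : IsReg (A \ B) :=
  Language.IsRegular.inf hA (Language.IsRegular.compl hB)

theorem isReg_rev {γ : Type} {A B : Set (List γ)} (hA : IsReg A) (h : ∀ w, w ∈ B ↔ w.reverse ∈ A) :
    IsReg B := by
  have := Language.IsRegular.reverse hA
  have e : B = (Language.reverse A : Language γ) := by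
    ext w; rw [h]; rfl
  rw [e]; exact this

theorem isReg_singleton {γ : Type} (v : List γ) : IsReg ({v} : Set (List γ)) := by
  induction v with
  | nil =>
    refine crit (fun b : Bool => if b then {[]} else ∅) (fun s p => ⟨false, fun w => ?_⟩) true
    cases s <;> simp
  | cons a v ih =>
    obtain ⟨σ, _, M, hM⟩ := ih
    have hM' : ∀ w, w ∈ M.acceptsFrom M.start ↔ w = v := by
      intro w
      have := Set.ext_iff.1 hM w
      exact this
    let K : Option (Option σ) → Set (List γ) := fun s => match s with
      | none => {a :: v}
      | some none => ∅
      | some (some q) => M.acceptsFrom q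
    refine crit K (fun s p => ?_) none
    rcases s with _ | _ | q
    · by_cases h : p = a
      · refine ⟨some (some M.start), fun w => ?_⟩
        subst h
        simp only [K, Set.mem_singleton_iff, List.cons.injEq, true_and]
        exact (hM' w).symm
      · exact ⟨some none, fun w => by simp [K, h]⟩
    · exact ⟨some none, fun w => by simp [K]⟩
    · exact ⟨some (some (M.step q p)), fun w => mem_acceptsFrom_cons M q p w⟩

theorem isReg_finite {γ : Type} {A : Set (List γ)} (h : A.Finite) : IsReg A := by
  induction A, h using Set.Finite.induction_on with
  | empty => exact isReg_empty
  | insert _ _ ih => rw [Set.insert_eq]; exact isReg_union (isReg_singleton _) ih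

theorem isReg_map {γ δ : Type} (F : γ → δ) (hF : Function.Injective F) {A : Set (List γ)}
    (hA : IsReg A) : IsReg (List.map F '' A) := by
  obtain ⟨σ, _, M, hM⟩ := hA
  let K : Option σ → Set (List δ) := fun s => match s with
    | none => ∅
    | some q => {w | ∃ x, x ∈ M.acceptsFrom q ∧ List.map F x = w}
  have : List.map F '' A = K (some M.start) := by
    rw [← hM]; rfl
  rw [this]
  refine crit K (fun s p => ?_) (some M.start)
  rcases s with _ | q
  · exact ⟨none, fun w => by simp [K]⟩
  · by_cases h : ∃ c, F c = p
    · obtain ⟨c, rfl⟩ := h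
      refine ⟨some (M.step q c), fun w => ?_⟩
      constructor
      · rintro ⟨x, hx, hxw⟩
        cases x with
        | nil => simp at hxw
        | cons y x =>
          simp only [List.map_cons, List.cons.injEq] at hxw
          obtain ⟨h1, h2⟩ := hxw
          rw [hF h1] at hx
          exact ⟨x, (mem_acceptsFrom_cons M q c x).1 hx, h2⟩
      · rintro ⟨x, hx, hxw⟩
        exact ⟨c :: x, (mem_acceptsFrom_cons M q c x).2 hx, by simp [hxw]⟩
    · refine ⟨none, fun w => ?_⟩
      simp only [K, Set.mem_ofPred_eq, Set.mem_empty_iff_false, iff_false]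
      rintro ⟨x, hx, hxw⟩
      cases x with
      | nil => simp at hxw
      | cons y x =>
        simp only [List.map_cons, List.cons.injEq] at hxw
        exact h ⟨y, hxw.1⟩

/-! ### Padding -/

theorem padR_cons {α : Type} (a b : α) (x y : List α) :
    padR (a :: x) (b :: y) = (some a, some b) :: padR x y := by
  simp [padR]

theorem padL_len {α : Type} (y0 : α) (x y : List α) (h : x.length = y.length) :
    padL x (y0 :: y) = (none, some y0) :: (x.map some).zip (y.map some) := by
  simp [padL, h]

theorem padL_eq {α : Type} (x y : List α) (h : x.length = y.length) :
    padL x y = padR x y := by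
  simp [padL, padR, h]

theorem padR_rev {α : Type} (x y : List α) :
    (padR x y).reverse = padL x.reverse y.reverse := by
  have : ∀ {β γ : Type} (l : List β) (m : List γ), l.length = m.length →
      (l.zip m).reverse = l.reverse.zip m.reverse := by
    intro β γ l m h
    simp only [List.zip]
    exact (List.reverse_zipWith h)
  unfold padR padL
  rw [this _ _ (by simp; omega)]
  simp

theorem padL_rev {α : Type} (x y : List α) :
    (padL x y).reverse = padR x.reverse y.reverse := by
  rw [← List.reverse_reverse (padR _ _), padR_rev]; simp

theorem padR_inj {α : Type} {x y x' y' : List α} (h : padR x y = padR x' y') : x = x' ∧ y = y' := by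
  have h1 : ∀ x y : List α, ((padR x y).map Prod.fst).reduceOption = x := by
    intro x y
    unfold padR
    rw [List.map_fst_zip (by simp; omega)]
    simp [List.reduceOption]
  have h2 : ∀ x y : List α, ((padR x y).map Prod.snd).reduceOption = y := by
    intro x y
    unfold padR
    rw [List.map_snd_zip (by simp; omega)]
    simp [List.reduceOption]
  exact ⟨by rw [← h1 x y, h, h1], by rw [← h2 x y, h, h2]⟩

theorem padL_inj {α : Type} {x y x' y' : List α} (h : padL x y = padL x' y') : x = x' ∧ y = y' := by
  have := congrArg List.reverse h
  rw [padL_rev, padL_rev] at this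
  have := padR_inj this
  simpa using this

theorem padR_map {α β : Type} (f : α → β) (x y : List α) :
    padR (x.map f) (y.map f) = (padR x y).map (Prod.map (Option.map f) (Option.map f)) := by
  unfold padR
  rw [← List.zip_map]
  simp [Function.comp_def]

theorem padL_map {α β : Type} (f : α → β) (x y : List α) :
    padL (x.map f) (y.map f) = (padL x y).map (Prod.map (Option.map f) (Option.map f)) := by
  unfold padL
  rw [← List.zip_map]
  simp [Function.comp_def]

/-! ### Shift -/

def shf {γ δ : Type} : γ → List (γ × δ) → List (γ × δ)
  | _, [] => []
  | p, (x, y) :: w => (p, y) :: shf x w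

def lastf {γ δ : Type} : γ → List (γ × δ) → γ
  | p, [] => p
  | _, (x, _) :: w => lastf x w

theorem shf_inj {γ δ : Type} (w w' : List (γ × δ)) : ∀ p, shf p w = shf p w' →
    lastf p w = lastf p w' → w = w' := by
  induction w generalizing w' with
  | nil => intro p; cases w' <;> simp [shf]
  | cons c w ih =>
    intro p
    obtain ⟨x, y⟩ := c
    cases w' with
    | nil => simp [shf]
    | cons c' w' =>
      obtain ⟨x', y'⟩ := c'
      simp only [shf, lastf, List.cons.injEq, Prod.mk.injEq, true_and]
      rintro ⟨rfl, h⟩ h'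
      have : x = x' := by
        cases w with
        | nil => cases w' with
          | nil => simpa [lastf] using h'
          | cons => simp [shf] at h
        | cons d w => cases w' with
          | nil => simp [shf] at h
          | cons d' w' => simp [shf] at h; exact h.1.1
      subst this
      exact ⟨⟨rfl, rfl⟩, ih w' x h h'⟩

theorem shf_pad {α : Type} (x y : List α) (y0 : α) (h : x.length = y.length) (p : Option α) :
    shf p (padR x (y0 :: y)) = (p, some y0) :: (x.map some).zip (y.map some) ∧
    lastf p (padR x (y0 :: y)) = none := by
  induction x generalizing y y0 p with
  | nil =>
    cases y with
    | nil => simp [padR, shf, lastf]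
    | cons => simp at h
  | cons a x ih =>
    cases y with
    | nil => simp at h
    | cons b y =>
      rw [padR_cons]
      have := ih y b (by simpa using h) (some a)
      simp only [shf, lastf, this]
      simp

theorem shift_reg {α : Type} [Finite α] {P : List α → List α → Prop}
    (hP : ∀ x y, P x y → y.length = x.length + 1)
    (h : IsReg {p | ∃ x y, P x y ∧ p = padL x y}) : IsReg {p | ∃ x y, P x y ∧ p = padR x y} := by
  obtain ⟨σ, _, M, hM⟩ := h
  have hM' : ∀ w, w ∈ M.acceptsFrom M.start ↔ ∃ x y, P x y ∧ w = padL x y := by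
    intro w
    exact Set.ext_iff.1 hM w
  have key : ∀ x y, P x y → shf none (padR x y) = padL x y ∧ lastf none (padR x y) = none := by
    intro x y hxy
    have := hP x y hxy
    cases y with
    | nil => simp at this
    | cons y0 y =>
      have h' : x.length = y.length := by simpa using this.symm
      rw [padL_len _ _ _ h']
      exact shf_pad x y y0 h' none
  let K : σ × Option α → Set (List (Option α × Option α)) := fun s =>
    {w | shf s.2 w ∈ M.acceptsFrom s.1 ∧ lastf s.2 w = none}
  have e : {p | ∃ x y, P x y ∧ p = padR x y} = K (M.start, none) := by
    ext w
    simp only [K, Set.mem_ofPred_eq, hM']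
    constructor
    · rintro ⟨x, y, hxy, rfl⟩
      exact ⟨⟨x, y, hxy, (key x y hxy).1⟩, (key x y hxy).2⟩
    · rintro ⟨⟨x, y, hxy, h1⟩, h2⟩
      refine ⟨x, y, hxy, shf_inj _ _ none ?_ ?_⟩
      · rw [h1, (key x y hxy).1]
      · rw [h2, (key x y hxy).2]
  rw [e]
  refine crit K (fun s p => ⟨(M.step s.1 (s.2, p.2), p.1), fun w => ?_⟩) _
  obtain ⟨x, y⟩ := p
  simp only [K, Set.mem_ofPred_eq, shf, lastf, mem_acceptsFrom_cons]

/-! ### Graphs of finite-state functions -/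

def DelayReg {α : Type} (f : List α → List α) : Prop :=
  ∃ (σ : Type) (_ : Finite σ) (Q : σ → List α → List α → Prop),
    (∀ s x y, ∃ s', ∀ xs ys, Q s (x :: xs) (y :: ys) ↔ Q s' xs ys) ∧
    ∀ y0, ∃ s, ∀ x y, f x = y0 :: y ↔ Q s x y

theorem graph_reg {α : Type} {f : List α → List α} (hf : DelayReg f) {I : Set (List α)}
    (hI : IsReg I) (hlen : ∀ x ∈ I, (f x).length = x.length + 1) :
    IsReg {p | ∃ x y, (x ∈ I ∧ y = f x) ∧ p = padL x y} := by
  obtain ⟨σ, _, Q, hQ, hf⟩ := hf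
  obtain ⟨τ, _, M, hM⟩ := hI
  have hM' : ∀ w, w ∈ M.acceptsFrom M.start ↔ w ∈ I := by
    intro w
    exact Set.ext_iff.1 hM w
  choose st hst using hQ
  choose ini hini using hf
  let K : Option (Option (τ × σ)) → Set (List (Option α × Option α)) := fun s => match s with
    | none => {p | ∃ x y, (x ∈ I ∧ y = f x) ∧ p = padL x y}
    | some none => ∅
    | some (some (t, s)) => {w | ∃ x y : List α, x.length = y.length ∧ x ∈ M.acceptsFrom t ∧ Q s x y ∧
        w = (x.map some).zip (y.map some)}
  refine crit K (fun s p => ?_) none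
  rcases s with _ | _ | ⟨t, s⟩
  · by_cases h : ∃ y0, p = (none, some y0)
    · obtain ⟨y0, rfl⟩ := h
      refine ⟨some (some (M.start, ini y0)), fun w => ?_⟩
      constructor
      · rintro ⟨x, y, ⟨hx, rfl⟩, hp⟩
        have hl := hlen x hx
        rcases hy : f x with _ | ⟨y1, y⟩
        · simp [hy] at hl
        · rw [hy] at hl hp
          have hl' : x.length = y.length := by simpa using hl.symm
          rw [padL_len _ _ _ hl'] at hp
          simp only [List.cons.injEq, Prod.mk.injEq, Option.some.injEq, true_and] at hp
          obtain ⟨rfl, hp⟩ := hp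
          exact ⟨x, y, hl', (hM' x).2 hx, (hini _ _ _).1 hy, hp⟩
      · rintro ⟨x, y, hl, hx, hq, rfl⟩
        refine ⟨x, y0 :: y, ⟨(hM' x).1 hx, ((hini _ _ _).2 hq).symm⟩, (padL_len _ _ _ hl).symm⟩
    · refine ⟨some none, fun w => ?_⟩
      simp only [K, Set.mem_ofPred_eq, Set.mem_empty_iff_false, iff_false]
      rintro ⟨x, y, ⟨hx, rfl⟩, hp⟩
      have hl := hlen x hx
      rcases hy : f x with _ | ⟨y1, y⟩
      · simp [hy] at hl
      · rw [hy] at hl hp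
        have hl' : x.length = y.length := by simpa using hl.symm
        rw [padL_len _ _ _ hl'] at hp
        simp only [List.cons.injEq] at hp
        exact h ⟨y1, hp.1⟩
  · exact ⟨some none, fun w => by simp [K]⟩
  · by_cases h : ∃ x0 y0, p = (some x0, some y0)
    · obtain ⟨x0, y0, rfl⟩ := h
      refine ⟨some (some (M.step t x0, st s x0 y0)), fun w => ?_⟩
      constructor
      · rintro ⟨x, y, hl, hx, hq, hp⟩
        rcases x with _ | ⟨x1, x⟩
        · simp at hp
        rcases y with _ | ⟨y1, y⟩
        · simp at hp
        simp at hp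
        obtain ⟨⟨rfl, rfl⟩, hp⟩ := hp
        exact ⟨x, y, by simpa using hl, (mem_acceptsFrom_cons _ _ _ _).1 hx, (hst _ _ _ _ _).1 hq, by simpa using hp⟩
      · rintro ⟨x, y, hl, hx, hq, rfl⟩
        exact ⟨x0 :: x, y0 :: y, by simpa using hl, (mem_acceptsFrom_cons _ _ _ _).2 hx,
          (hst _ _ _ _ _).2 hq, by simp⟩
    · refine ⟨some none, fun w => ?_⟩
      simp only [K, Set.mem_ofPred_eq, Set.mem_empty_iff_false, iff_false]
      rintro ⟨x, y, hl, hx, hq, hp⟩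
      rcases x with _ | ⟨x1, x⟩
      · simp at hp
      rcases y with _ | ⟨y1, y⟩
      · simp at hp
      simp only [List.map_cons, List.zip_cons_cons, List.cons.injEq] at hp
      exact h ⟨x1, y1, hp.1⟩

/-! ### From normal forms to (bi)automatic structures -/

def rep {α : Type} : List α → List (Option α)
  | [] => [none]
  | x :: xs => (x :: xs).map some

theorem rep_ne {α : Type} (x : List α) : rep x ≠ [] := by cases x <;> simp [rep]

theorem rep_of_ne {α : Type} {x : List α} (h : x ≠ []) : rep x = x.map some := by
  cases x
  · exact absurd rfl h
  · rfl

theorem expand_map {α : Type} (x : List α) : expandW (Option.toList) (x.map some) = x := by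
  induction x with
  | nil => rfl
  | cons a x ih => simpa [expandW] using ih

theorem expand_rep {α : Type} (x : List α) : expandW (Option.toList) (rep x) = x := by
  cases x with
  | nil => rfl
  | cons a x => exact expand_map _

theorem rep_reg {α : Type} [Finite α]
    (pa : List α → List α → List (Option α × Option α))
    (pb : List (Option α) → List (Option α) → List (Option (Option α) × Option (Option α)))
    (pinj : ∀ {x y x' y'}, pa x y = pa x' y' → x = x' ∧ y = y')
    (pmap : ∀ x y, pb (x.map some) (y.map some) =
      (pa x y).map (Prod.map (Option.map some) (Option.map some)))
    {P : List α → List α → Prop} (hP1 : ∀ x y, P x y → x.length ≤ y.length)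
    (hP2 : ∀ x y, P x y → y.length ≤ x.length + 1)
    (h : IsReg {p | ∃ x y, P x y ∧ p = pa x y}) :
    IsReg {p | ∃ x y, P x y ∧ p = pb (rep x) (rep y)} := by
  let F : Set (List α × List α) := {q | P q.1 q.2 ∧ (q.1 = [] ∨ q.2 = [])}
  have hF : F.Finite := by
    refine Set.Finite.subset ((List.finite_length_le α 1).prod (List.finite_length_le α 1)) ?_
    rintro ⟨x, y⟩ ⟨h1, h2⟩
    have h3 := hP1 _ _ h1
    have h4 := hP2 _ _ h1
    simp only at h2 h3 h4
    rcases h2 with rfl | rfl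
    · simpa using h4
    · simp only [List.length_nil] at h3
      constructor <;> simp <;> omega
  have e : {p | ∃ x y, P x y ∧ p = pb (rep x) (rep y)} =
      List.map (Prod.map (Option.map some) (Option.map some)) ''
        ({p | ∃ x y, P x y ∧ p = pa x y} \ ((fun q => pa q.1 q.2) '' F)) ∪
      ((fun q => pb (rep q.1) (rep q.2)) '' F) := by
    ext p
    constructor
    · rintro ⟨x, y, hxy, rfl⟩
      by_cases hn : x = [] ∨ y = []
      · exact Or.inr ⟨(x, y), ⟨hxy, hn⟩, rfl⟩
      · refine Or.inl ⟨pa x y, ⟨⟨x, y, hxy, rfl⟩, ?_⟩, ?_⟩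
        · rintro ⟨⟨x', y'⟩, ⟨_, h2⟩, h3⟩
          obtain ⟨rfl, rfl⟩ := pinj h3
          exact hn h2
        · push Not at hn
          rw [rep_of_ne hn.1, rep_of_ne hn.2, pmap]
    · rintro (⟨_, ⟨⟨x, y, hxy, rfl⟩, hn⟩, rfl⟩ | ⟨⟨x, y⟩, ⟨h1, h2⟩, rfl⟩)
      · have hn' : ¬ (x = [] ∨ y = []) := fun h' => hn ⟨(x, y), ⟨hxy, h'⟩, rfl⟩
        push Not at hn'
        exact ⟨x, y, hxy, by rw [rep_of_ne hn'.1, rep_of_ne hn'.2, pmap]⟩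
      · exact ⟨x, y, h1, rfl⟩
  rw [e]
  refine isReg_union (isReg_map _ ?_ (isReg_diff h (isReg_finite (hF.image _)))) (isReg_finite (hF.image _))
  have hi : Function.Injective (Option.map (some : α → Option α)) :=
    Option.map_injective (Option.some_injective _)
  exact hi.prodMap hi

theorem isReg_congr {γ : Type} {A B : Set (List γ)} (hA : IsReg A) (h : ∀ w, w ∈ B ↔ w ∈ A) :
    IsReg B := by
  have : B = A := Set.ext h
  rwa [this]

theorem main_gen {α : Type} [Fintype α] (R : Set (List α × List α)) (I : Set (List α))
    (hlen : ∀ x y, WordEq R x y → x.length = y.length)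
    (hnil : [] ∈ I) (hpre : ∀ x ∈ I, ∀ y, y <+: x → y ∈ I)
    (huniq : ∀ x ∈ I, ∀ y ∈ I, WordEq R x y → x = y)
    (honto : ∀ w, ∃ x ∈ I, WordEq R x w)
    (hreg : IsReg I)
    (hLL : ∀ b, IsReg {p | ∃ x y, (x ∈ I ∧ y ∈ I ∧ WordEq R (b :: x) y) ∧ p = padL x y})
    (hLR : ∀ b, IsReg {p | ∃ x y, (x ∈ I ∧ y ∈ I ∧ WordEq R (b :: x) y) ∧ p = padR x y})
    (hRL : ∀ b, IsReg {p | ∃ x y, (x ∈ I ∧ y ∈ I ∧ WordEq R (x ++ [b]) y) ∧ p = padL x y})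
    (hRR : ∀ b, IsReg {p | ∃ x y, (x ∈ I ∧ y ∈ I ∧ WordEq R (x ++ [b]) y) ∧ p = padR x y}) :
    MonBiautomatic R ∧ MonPrefixAutomatic R := by
  have hdR : ∀ x : List α, padR x x = x.map (fun a => (some a, some a)) := by
    intro x
    induction x with
    | nil => rfl
    | cons a x ih => rw [padR_cons, ih]; rfl
  have eR0 : IsReg {p | ∃ x y, (x ∈ I ∧ y ∈ I ∧ WordEq R x y) ∧ p = padR x y} := by
    refine isReg_congr (isReg_map (fun a : α => (some a, some a)) (fun a b h => by simpa using h) hreg) ?_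
    intro w
    constructor
    · rintro ⟨x, y, ⟨hx, hy, hxy⟩, rfl⟩
      obtain rfl := huniq x hx y hy hxy
      exact ⟨x, hx, (hdR x).symm⟩
    · rintro ⟨x, hx, rfl⟩
      exact ⟨x, x, ⟨hx, hx, Relation.EqvGen.refl _⟩, (hdR x).symm⟩
  have eL0 : IsReg {p | ∃ x y, (x ∈ I ∧ y ∈ I ∧ WordEq R x y) ∧ p = padL x y} := by
    refine isReg_congr eR0 ?_
    intro w
    constructor
    · rintro ⟨x, y, h, rfl⟩
      exact ⟨x, y, h, padL_eq _ _ (hlen _ _ h.2.2)⟩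
    · rintro ⟨x, y, h, rfl⟩
      exact ⟨x, y, h, (padL_eq _ _ (hlen _ _ h.2.2)).symm⟩
  let L : Set (List (Option α)) := rep '' I
  let g : Option α → List α := Option.toList
  -- transfer
  have tr : ∀ (pb : List (Option α) → List (Option α) → List (Option (Option α) × Option (Option α)))
      (E E' : List α → List α → Prop), (∀ x y, E x y ↔ E' x y) →
      IsReg {p | ∃ x y, (x ∈ I ∧ y ∈ I ∧ E x y) ∧ p = pb (rep x) (rep y)} →
      IsReg {p | ∃ x ∈ L, ∃ y ∈ L, E' (expandW g x) (expandW g y) ∧ p = pb x y} := by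
    intro pb E E' hE h
    refine isReg_congr h ?_
    intro w
    constructor
    · rintro ⟨_, ⟨x, hx, rfl⟩, _, ⟨y, hy, rfl⟩, h, rfl⟩
      rw [expand_rep, expand_rep] at h
      exact ⟨x, y, ⟨hx, hy, (hE _ _).2 h⟩, rfl⟩
    · rintro ⟨x, y, ⟨hx, hy, h⟩, rfl⟩
      refine ⟨_, ⟨x, hx, rfl⟩, _, ⟨y, hy, rfl⟩, ?_, rfl⟩
      rw [expand_rep, expand_rep]
      exact (hE _ _).1 h
  have eR : IsReg {p | ∃ x y, (x ∈ I ∧ y ∈ I ∧ WordEq R x y) ∧ p = padR (rep x) (rep y)} :=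
    rep_reg padR padR padR_inj (padR_map _) (fun x y h => (hlen _ _ h.2.2).le)
      (fun x y h => by have := hlen _ _ h.2.2; omega) eR0
  have eL : IsReg {p | ∃ x y, (x ∈ I ∧ y ∈ I ∧ WordEq R x y) ∧ p = padL (rep x) (rep y)} :=
    rep_reg padL padL padL_inj (padL_map _) (fun x y h => (hlen _ _ h.2.2).le)
      (fun x y h => by have := hlen _ _ h.2.2; omega) eL0
  have l1 : ∀ x y : List α, ∀ b, x ∈ I ∧ y ∈ I ∧ WordEq R (b :: x) y → y.length = x.length + 1 := by
    intro x y b h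
    have := hlen _ _ h.2.2
    simpa using this.symm
  have l2 : ∀ x y : List α, ∀ b, x ∈ I ∧ y ∈ I ∧ WordEq R (x ++ [b]) y → y.length = x.length + 1 := by
    intro x y b h
    have := hlen _ _ h.2.2
    simpa using this.symm
  have regL : IsReg L := by
    let F : α → Option α := some
    refine isReg_congr (isReg_union (isReg_map F (Option.some_injective _)
      (isReg_diff hreg (isReg_singleton []))) (isReg_singleton [none])) ?_
    intro w
    constructor
    · rintro ⟨x, hx, rfl⟩
      by_cases h : x = []
      · subst h; exact Or.inr rfl
      · exact Or.inl ⟨x, ⟨hx, h⟩, (rep_of_ne h).symm⟩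
    · rintro (⟨x, ⟨hx, h⟩, rfl⟩ | h)
      · exact ⟨x, hx, rep_of_ne h⟩
      · exact ⟨[], hnil, h.symm⟩
  have neL : ∀ w ∈ L, w ≠ [] := by
    rintro _ ⟨x, _, rfl⟩
    exact rep_ne x
  have ontoL : ∀ w : List α, ∃ x ∈ L, WordEq R (expandW g x) w := by
    intro w
    obtain ⟨x, hx, h⟩ := honto w
    exact ⟨_, ⟨x, hx, rfl⟩, by rw [expand_rep]; exact h⟩
  have eqR : IsReg {p | ∃ x ∈ L, ∃ y ∈ L, WordEq R (expandW g x) (expandW g y) ∧ p = padR x y} :=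
    tr padR (fun x y => WordEq R x y) _ (fun _ _ => Iff.rfl) eR
  have eqL : IsReg {p | ∃ x ∈ L, ∃ y ∈ L, WordEq R (expandW g x) (expandW g y) ∧ p = padL x y} :=
    tr padL (fun x y => WordEq R x y) _ (fun _ _ => Iff.rfl) eL
  have mRR : ∀ b, IsReg {p | ∃ x ∈ L, ∃ y ∈ L,
      WordEq R (expandW g x ++ g b) (expandW g y) ∧ p = padR x y} := by
    rintro (_ | b)
    · exact tr padR (fun x y => WordEq R x y) (fun x y => WordEq R (x ++ g none) y)
        (fun _ _ => by simp [g]) eR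
    · exact tr padR _ (fun x y => WordEq R (x ++ g (some b)) y) (fun _ _ => Iff.rfl)
        (rep_reg padR padR padR_inj (padR_map _) (fun x y h => by have := l2 x y b h; omega)
          (fun x y h => by have := l2 x y b h; omega) (hRR b))
  have mRL : ∀ b, IsReg {p | ∃ x ∈ L, ∃ y ∈ L,
      WordEq R (expandW g x ++ g b) (expandW g y) ∧ p = padL x y} := by
    rintro (_ | b)
    · exact tr padL (fun x y => WordEq R x y) (fun x y => WordEq R (x ++ g none) y)
        (fun _ _ => by simp [g]) eL
    · exact tr padL _ (fun x y => WordEq R (x ++ g (some b)) y) (fun _ _ => Iff.rfl)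
        (rep_reg padL padL padL_inj (padL_map _) (fun x y h => by have := l2 x y b h; omega)
          (fun x y h => by have := l2 x y b h; omega) (hRL b))
  have mLR : ∀ b, IsReg {p | ∃ x ∈ L, ∃ y ∈ L,
      WordEq R (g b ++ expandW g x) (expandW g y) ∧ p = padR x y} := by
    rintro (_ | b)
    · exact tr padR (fun x y => WordEq R x y) (fun x y => WordEq R (g none ++ x) y)
        (fun _ _ => by simp [g]) eR
    · exact tr padR _ (fun x y => WordEq R (g (some b) ++ x) y) (fun _ _ => Iff.rfl)
        (rep_reg padR padR padR_inj (padR_map _) (fun x y h => by have := l1 x y b h; omega)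
          (fun x y h => by have := l1 x y b h; omega) (hLR b))
  have mLL : ∀ b, IsReg {p | ∃ x ∈ L, ∃ y ∈ L,
      WordEq R (g b ++ expandW g x) (expandW g y) ∧ p = padL x y} := by
    rintro (_ | b)
    · exact tr padL (fun x y => WordEq R x y) (fun x y => WordEq R (g none ++ x) y)
        (fun _ _ => by simp [g]) eL
    · exact tr padL _ (fun x y => WordEq R (g (some b) ++ x) y) (fun _ _ => Iff.rfl)
        (rep_reg padL padL padL_inj (padL_map _) (fun x y h => by have := l1 x y b h; omega)
          (fun x y h => by have := l1 x y b h; omega) (hLL b))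
  refine ⟨⟨Option α, inferInstance, g, L, regL, neL, ontoL, eqR, eqL, mRR, mLR, mRL, mLL⟩,
    ⟨Option α, inferInstance, g, L, ⟨regL, neL, ontoL, eqR, mRR⟩, ?_⟩⟩
  -- prefixes
  have prefL : ∀ y : List (Option α), (∃ z ∈ L, y <+: z) ↔ y = [] ∨ y ∈ L := by
    intro y
    constructor
    · rintro ⟨_, ⟨x, hx, rfl⟩, hy⟩
      by_cases hyn : y = []
      · exact Or.inl hyn
      right
      by_cases h : x = []
      · subst h
        refine ⟨[], hnil, ?_⟩
        rcases y with _ | ⟨c, y⟩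
        · exact absurd rfl hyn
        · simp [rep] at hy ⊢
          exact ⟨hy.1.symm, hy.2⟩
      · rw [rep_of_ne h] at hy
        rw [List.prefix_map_iff] at hy
        obtain ⟨z, hz, rfl⟩ := hy
        exact ⟨z, hpre x hx z hz, rep_of_ne (by rintro rfl; exact hyn rfl)⟩
    · rintro (rfl | h)
      · exact ⟨_, ⟨[], hnil, rfl⟩, List.nil_prefix⟩
      · exact ⟨y, h, List.prefix_rfl⟩
  refine isReg_congr (isReg_union eqR (isReg_singleton (padR [none] []))) ?_
  intro w
  constructor
  · rintro ⟨x, hx, y, hy, h, rfl⟩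
    rcases (prefL y).1 hy with rfl | hy
    · right
      obtain ⟨x, hx, rfl⟩ := hx
      rw [expand_rep] at h
      have := hlen _ _ h
      simp [expandW] at this
      subst this
      rfl
    · exact Or.inl ⟨x, hx, y, hy, h, rfl⟩
  · rintro (⟨x, hx, y, hy, h, rfl⟩ | rfl)
    · exact ⟨x, hx, y, (prefL y).2 (Or.inr hy), h, rfl⟩
    · exact ⟨[none], ⟨[], hnil, rfl⟩, [], (prefL []).2 (Or.inl rfl), Relation.EqvGen.refl _, rfl⟩

/-! ### Word equality basics -/

theorem WordEq.rfl' {α : Type} {R : Set (List α × List α)} (x : List α) : WordEq R x x :=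
  Relation.EqvGen.refl _

theorem WordEq.symm' {α : Type} {R : Set (List α × List α)} {x y : List α} (h : WordEq R x y) :
    WordEq R y x := Relation.EqvGen.symm _ _ h

theorem WordEq.trans' {α : Type} {R : Set (List α × List α)} {x y z : List α} (h : WordEq R x y)
    (h' : WordEq R y z) : WordEq R x z := Relation.EqvGen.trans _ _ _ h h'

theorem WordEq.ctx {α : Type} {R : Set (List α × List α)} {x y : List α} (h : WordEq R x y)
    (p s : List α) : WordEq R (p ++ x ++ s) (p ++ y ++ s) := by
  induction h with
  | rel x y h =>
    obtain ⟨p', u, v, s', h, rfl, rfl⟩ := h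
    exact Relation.EqvGen.rel _ _ ⟨p ++ p', u, v, s' ++ s, h, by simp, by simp⟩
  | refl x => exact WordEq.rfl' _
  | symm x y _ ih => exact ih.symm'
  | trans x y z _ _ ih1 ih2 => exact ih1.trans' ih2

theorem WordEq.base {α : Type} {R : Set (List α × List α)} {x y : List α} (h : (x, y) ∈ R) :
    WordEq R x y := Relation.EqvGen.rel _ _ ⟨[], x, y, [], h, by simp, by simp⟩

/-- Abstract congruences on words. -/
structure Cong {α : Type} (E : List α → List α → Prop) : Prop where
  refl : ∀ x, E x x
  symm : ∀ {x y}, E x y → E y x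
  trans : ∀ {x y z}, E x y → E y z → E x z
  ctx : ∀ {x y}, E x y → ∀ p s, E (p ++ x ++ s) (p ++ y ++ s)

theorem Cong.cons {α : Type} {E : List α → List α → Prop} (h : Cong E) {x y : List α} (e : E x y)
    (a : α) : E (a :: x) (a :: y) := by simpa using h.ctx e [a] []

theorem Cong.app {α : Type} {E : List α → List α → Prop} (h : Cong E) {x y : List α} (e : E x y)
    (s : List α) : E (x ++ s) (y ++ s) := by simpa using h.ctx e [] s

theorem cong_word {α : Type} (R : Set (List α × List α)) : Cong (WordEq R) :=
  ⟨WordEq.rfl', WordEq.symm', WordEq.trans', WordEq.ctx⟩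

theorem cong_rev {α : Type} (R : Set (List α × List α)) :
    Cong (fun x y : List α => WordEq R x.reverse y.reverse) :=
  ⟨fun _ => WordEq.rfl' _, WordEq.symm', WordEq.trans', fun h p s => by
    simpa using WordEq.ctx h s.reverse p.reverse⟩

theorem build {α : Type} [Fintype α] (R : Set (List α × List α)) (I : Set (List α))
    (ml mr : α → List α → List α)
    (hR : ∀ q ∈ R, q.1.length = q.2.length)
    (hI : ∀ x ∈ I, ∀ y, y <:+: x → y ∈ I) (hnil : [] ∈ I) (hreg : IsReg I)
    (ml_mem : ∀ e, ∀ x ∈ I, ml e x ∈ I)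
    (ml_eq : ∀ e, ∀ x ∈ I, WordEq R (e :: x) (ml e x))
    (ml_irr : ∀ e x, e :: x ∈ I → ml e x = e :: x)
    (ml_rel : ∀ q ∈ R, ∀ x ∈ I, q.1.foldr ml x = q.2.foldr ml x)
    (mr_mem : ∀ e x, x.reverse ∈ I → (mr e x).reverse ∈ I)
    (mr_eq : ∀ e x, x.reverse ∈ I → WordEq R (e :: x).reverse (mr e x).reverse)
    (mlQ : ∀ e, DelayReg (ml e)) (mrQ : ∀ e, DelayReg (mr e)) :
    MonBiautomatic R ∧ MonPrefixAutomatic R := by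
  have hlen : ∀ x y, WordEq R x y → x.length = y.length := by
    intro x y h
    induction h with
    | rel x y h =>
      obtain ⟨p', u, v, s', h, rfl, rfl⟩ := h
      simpa using hR _ h
    | refl x => rfl
    | symm x y _ ih => exact ih.symm
    | trans x y z _ _ ih1 ih2 => exact ih1.trans ih2
  have nf_mem : ∀ w : List α, w.foldr ml [] ∈ I := by
    intro w
    induction w with
    | nil => exact hnil
    | cons e w ih => exact ml_mem e _ ih
  have nf_eq : ∀ w : List α, WordEq R w (w.foldr ml []) := by
    intro w
    induction w with
    | nil => exact WordEq.rfl' _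
    | cons e w ih => exact ((cong_word R).cons ih e).trans' (ml_eq e _ (nf_mem w))
  have nf_self : ∀ x ∈ I, x.foldr ml [] = x := by
    intro x
    induction x with
    | nil => intro _; rfl
    | cons e x ih =>
      intro h
      rw [List.foldr_cons, ih (hI _ h _ (List.suffix_cons e x).isInfix), ml_irr _ _ h]
  have nf_congr : ∀ x y, WordEq R x y → x.foldr ml [] = y.foldr ml [] := by
    intro x y h
    induction h with
    | rel x y h =>
      obtain ⟨p', u, v, s', h, rfl, rfl⟩ := h
      simp only [List.foldr_append]
      rw [ml_rel _ h _ (nf_mem s')]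
    | refl x => rfl
    | symm x y _ ih => exact ih.symm
    | trans x y z _ _ ih1 ih2 => exact ih1.trans ih2
  have huniq : ∀ x ∈ I, ∀ y ∈ I, WordEq R x y → x = y := by
    intro x hx y hy h
    rw [← nf_self x hx, ← nf_self y hy, nf_congr x y h]
  have mll : ∀ e, ∀ x ∈ I, (ml e x).length = x.length + 1 := by
    intro e x hx
    have := hlen _ _ (ml_eq e x hx)
    simpa using this.symm
  have mrl : ∀ e x, x.reverse ∈ I → (mr e x).length = x.length + 1 := by
    intro e x hx
    have := hlen _ _ (mr_eq e x hx)
    simpa using this.symm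
  have hLL : ∀ b, IsReg {p | ∃ x y, (x ∈ I ∧ y ∈ I ∧ WordEq R (b :: x) y) ∧ p = padL x y} := by
    intro b
    refine isReg_congr (graph_reg (mlQ b) hreg (mll b)) ?_
    intro w
    constructor
    · rintro ⟨x, y, ⟨hx, hy, h⟩, rfl⟩
      exact ⟨x, y, ⟨hx, huniq _ hy _ (ml_mem b x hx) (h.symm'.trans' (ml_eq b x hx))⟩, rfl⟩
    · rintro ⟨x, y, ⟨hx, rfl⟩, rfl⟩
      exact ⟨x, _, ⟨hx, ml_mem b x hx, ml_eq b x hx⟩, rfl⟩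
  have hrev : IsReg {x : List α | x.reverse ∈ I} := isReg_rev hreg (fun w => Iff.rfl)
  have hr0 : ∀ b, IsReg {p | ∃ x y, (x ∈ {x : List α | x.reverse ∈ I} ∧ y = mr b x) ∧ p = padL x y} :=
    fun b => graph_reg (mrQ b) hrev (mrl b)
  have hr1 : ∀ b, IsReg {p | ∃ x y, (x ∈ {x : List α | x.reverse ∈ I} ∧ y = mr b x) ∧ p = padR x y} := by
    intro b
    refine shift_reg ?_ (hr0 b)
    rintro x y ⟨hx, rfl⟩
    exact mrl b x hx
  have hch : ∀ b x y, (x ∈ I ∧ y ∈ I ∧ WordEq R (x ++ [b]) y) ↔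
      (x.reverse ∈ {x : List α | x.reverse ∈ I} ∧ y.reverse = mr b x.reverse) := by
    intro b x y
    have e1 : x.reverse ∈ {x : List α | x.reverse ∈ I} ↔ x ∈ I := by simp
    rw [e1]
    constructor
    · rintro ⟨hx, hy, h⟩
      have hx' : x.reverse.reverse ∈ I := by simpa using hx
      have h2 := mr_eq b x.reverse hx'
      simp only [List.reverse_cons, List.reverse_reverse] at h2
      have := huniq _ hy _ (mr_mem b _ hx') (h.symm'.trans' h2)
      exact ⟨hx, by rw [this]; simp⟩
    · rintro ⟨hx, hy⟩
      have hx' : x.reverse.reverse ∈ I := by simpa using hx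
      have h2 := mr_eq b x.reverse hx'
      simp only [List.reverse_cons, List.reverse_reverse] at h2
      have h3 := mr_mem b _ hx'
      rw [← hy] at h2 h3
      simp only [List.reverse_reverse] at h2 h3
      exact ⟨hx, h3, h2⟩
  refine main_gen R I hlen hnil (fun x hx y hy => hI x hx y hy.isInfix) huniq
    (fun w => ⟨_, nf_mem w, (nf_eq w).symm'⟩) hreg hLL
    (fun b => shift_reg (fun x y h => by simpa using (hlen _ _ h.2.2).symm) (hLL b)) ?_ ?_
  · intro b
    refine isReg_rev (hr1 b) ?_
    intro w
    constructor
    · rintro ⟨x, y, h, rfl⟩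
      exact ⟨x.reverse, y.reverse, (hch b x y).1 h, padL_rev x y⟩
    · rintro ⟨x, y, h, hw⟩
      refine ⟨x.reverse, y.reverse, (hch b _ _).2 (by simpa using h), ?_⟩
      rw [← padR_rev, ← hw, List.reverse_reverse]
  · intro b
    refine isReg_rev (hr0 b) ?_
    intro w
    constructor
    · rintro ⟨x, y, h, rfl⟩
      exact ⟨x.reverse, y.reverse, (hch b x y).1 h, padR_rev x y⟩
    · rintro ⟨x, y, h, hw⟩
      refine ⟨x.reverse, y.reverse, (hch b _ _).2 (by simpa using h), ?_⟩
      rw [← padL_rev, ← hw, List.reverse_reverse]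

/-! ### Regularity of irreducible words -/

theorem avoid2 {α : Type} [Finite α] (a b : α) : IsReg {x : List α | ¬ [a, b] <:+: x} := by
  classical
  let K : Option (Option α) → Set (List α) := fun s => match s with
    | none => {x | ¬ [a, b] <:+: x}
    | some none => ∅
    | some (some q) => {x | ¬ [a, b] <:+: q :: x}
  refine crit K (fun s p => ?_) none
  rcases s with _ | _ | q
  · exact ⟨some (some p), fun w => Iff.rfl⟩
  · exact ⟨some none, fun w => Iff.rfl⟩
  · by_cases h : a = q ∧ b = p
    · refine ⟨some none, fun w => ?_⟩
      simp [K, List.infix_cons_iff, h]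
    · refine ⟨some (some p), fun w => ?_⟩
      simp only [K, Set.mem_ofPred_eq]
      rw [List.infix_cons_iff]
      simp only [List.cons_prefix_cons, List.nil_prefix, and_true]
      tauto

theorem avoid3 {α : Type} [Finite α] (a b c : α) : IsReg {x : List α | ¬ [a, b, c] <:+: x} := by
  classical
  let K : Option (Option (α ⊕ α × α)) → Set (List α) := fun s => match s with
    | none => {x | ¬ [a, b, c] <:+: x}
    | some none => ∅
    | some (some (Sum.inl q)) => {x | ¬ [a, b, c] <:+: q :: x}
    | some (some (Sum.inr (q, r))) => {x | ¬ [a, b, c] <:+: q :: r :: x}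
  refine crit K (fun s p => ?_) none
  rcases s with _ | _ | q | ⟨q, r⟩
  · exact ⟨some (some (Sum.inl p)), fun w => Iff.rfl⟩
  · exact ⟨some none, fun w => Iff.rfl⟩
  · exact ⟨some (some (Sum.inr (q, p))), fun w => Iff.rfl⟩
  · by_cases h : a = q ∧ b = r ∧ c = p
    · refine ⟨some none, fun w => ?_⟩
      simp [K, List.infix_cons_iff, h]
    · refine ⟨some (some (Sum.inr (r, p))), fun w => ?_⟩
      simp only [K, Set.mem_ofPred_eq]
      rw [List.infix_cons_iff]
      simp only [List.cons_prefix_cons, List.nil_prefix, and_true]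
      tauto

/-! ### First case: `ab → cd` with `a ≠ b` -/

def ml1 {α : Type} [DecidableEq α] (a b c d : α) : α → List α → List α
  | e, [] => [e]
  | e, x :: xs => if e = a ∧ x = b then c :: ml1 a b c d d xs else e :: ml1 a b c d x xs

theorem ml1_eq {α : Type} [DecidableEq α] {a b c d : α} {E : List α → List α → Prop} (hE : Cong E)
    (h : E [a, b] [c, d]) (e : α) (x : List α) : E (e :: x) (ml1 a b c d e x) := by
  induction x generalizing e with
  | nil => exact hE.refl _
  | cons y x ih =>
    rw [ml1]
    split_ifs with h1
    · obtain ⟨rfl, rfl⟩ := h1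
      exact hE.trans (hE.app h x) (hE.cons (ih d) c)
    · exact hE.cons (ih y) e

theorem ml1_irr {α : Type} [DecidableEq α] {a b c d : α} (e : α) (x : List α)
    (h : ¬ [a, b] <:+: e :: x) : ml1 a b c d e x = e :: x := by
  induction x generalizing e with
  | nil => rfl
  | cons y x ih =>
    rw [List.infix_cons_iff] at h
    push Not at h
    have h1 : ¬ (e = a ∧ y = b) := by
      rintro ⟨rfl, rfl⟩
      exact h.1 (by simp)
    rw [ml1, if_neg h1, ih y h.2]

theorem ml1_head {α : Type} [DecidableEq α] {a b c d : α} (e : α) (x : List α) :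
    ∃ z, ml1 a b c d e x = e :: z ∨ (e = a ∧ ml1 a b c d e x = c :: z) := by
  cases x with
  | nil => exact ⟨[], Or.inl rfl⟩
  | cons y x =>
    rw [ml1]
    split_ifs with h1
    · exact ⟨_, Or.inr ⟨h1.1, rfl⟩⟩
    · exact ⟨_, Or.inl rfl⟩

theorem ml1_c {α : Type} [DecidableEq α] {a b c d : α} (hab : a ≠ b) (hcd : ¬ (c = a ∧ d = b)) (x : List α)
    (h : ¬ [a, b] <:+: ml1 a b c d d x) : ¬ [a, b] <:+: c :: ml1 a b c d d x := by
  rw [List.infix_cons_iff]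
  obtain ⟨z, hz⟩ := ml1_head (a := a) (b := b) (c := c) (d := d) d x
  rintro (h1 | h1)
  · rcases hz with hz | ⟨h2, hz⟩
    · rw [hz] at h1
      simp at h1
      exact hcd ⟨h1.1.symm, h1.2.symm⟩
    · rw [hz] at h1
      simp at h1
      exact hab (h1.1.trans h1.2.symm)
  · exact h h1

theorem ml1_mem {α : Type} [DecidableEq α] {a b c d : α} (hab : a ≠ b) (hcd : ¬ (c = a ∧ d = b))
    (e : α) (x : List α)
    (h : ¬ [a, b] <:+: x) : ¬ [a, b] <:+: ml1 a b c d e x := by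
  induction x generalizing e with
  | nil => simp [ml1, List.infix_cons_iff]
  | cons y x ih =>
    have hx : ¬ [a, b] <:+: x := fun h' => h (List.infix_cons h')
    rw [ml1]
    split_ifs with h1
    · exact ml1_c hab hcd x (ih d hx)
    · rw [ml1_irr y x h, List.infix_cons_iff]
      rintro (h2 | h2)
      · simp at h2
        exact h1 ⟨h2.1.symm, h2.2.symm⟩
      · exact h h2

theorem ml1_rel {α : Type} [DecidableEq α] {a b c d : α} (hab : a ≠ b) (hcd : ¬ (c = a ∧ d = b))
    (x : List α) (h : ¬ [a, b] <:+: x) :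
    ml1 a b c d a (ml1 a b c d b x) = ml1 a b c d c (ml1 a b c d d x) := by
  have h1 : ml1 a b c d b x = b :: x := by
    apply ml1_irr
    rw [List.infix_cons_iff]
    rintro (h2 | h2)
    · simp at h2
      exact hab h2.1
    · exact h h2
  rw [h1, ml1, if_pos ⟨rfl, rfl⟩]
  exact (ml1_irr c _ (ml1_c hab hcd x (ml1_mem hab hcd d x h))).symm

theorem ml1_delay {α : Type} [Finite α] [DecidableEq α] (a b c d e : α) : DelayReg (ml1 a b c d e) := by
  refine ⟨Option (α × α), inferInstance, fun s x y => match s with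
    | none => False
    | some (e, y0) => ml1 a b c d e x = y0 :: y, ?_, fun y0 => ⟨some (e, y0), fun x y => Iff.rfl⟩⟩
  rintro (_ | ⟨e, y0⟩) x y
  · exact ⟨none, fun _ _ => Iff.rfl⟩
  · by_cases h1 : e = a ∧ x = b
    · by_cases h2 : c = y0
      · exact ⟨some (d, y), fun xs ys => by simp [ml1, h1, h2]⟩
      · exact ⟨none, fun xs ys => by simp [ml1, h1, h2]⟩
    · by_cases h2 : e = y0
      · exact ⟨some (x, y), fun xs ys => by simp only [ml1, if_neg h1]; simp [h2]⟩
      · exact ⟨none, fun xs ys => by simp only [ml1, if_neg h1]; simp [h2]⟩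

theorem rev_avoid2 {α : Type} (a b : α) (x : List α) : [a, b] <:+: x.reverse ↔ [b, a] <:+: x := by
  have := List.reverse_infix (l₁ := [b, a]) (l₂ := x)
  simpa using this

theorem case1 {α : Type} [Fintype α] (R : Set (List α × List α)) (a b c d : α) (hab : a ≠ b)
    (hcd : ¬ (c = a ∧ d = b)) (hR : R = {([a, b], [c, d])} ∨ R = {([c, d], [a, b])}) :
    MonBiautomatic R ∧ MonPrefixAutomatic R := by
  classical
  have hbase : WordEq R [a, b] [c, d] := by
    rcases hR with rfl | rfl
    · exact WordEq.base rfl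
    · exact WordEq.symm' (WordEq.base (Set.mem_singleton _))
  refine build R {x | ¬ [a, b] <:+: x} (ml1 a b c d) (ml1 b a d c) ?_ ?_ ?_ (avoid2 a b)
    (fun e x hx => ml1_mem hab hcd e x hx) (fun e x _ => ml1_eq (cong_word R) hbase e x)
    (fun e x hx => ml1_irr e x hx) ?_ ?_ (fun e x _ => ml1_eq (cong_rev R) hbase e x)
    (ml1_delay _ _ _ _) (ml1_delay _ _ _ _)
  · rcases hR with rfl | rfl <;> simp
  · intro x hx y hy h
    exact hx (h.trans hy)
  · simp
  · intro q hq x hx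
    have := ml1_rel hab hcd x hx
    rcases hR with rfl | rfl
    · rw [Set.mem_singleton_iff] at hq
      subst hq
      exact this
    · rw [Set.mem_singleton_iff] at hq
      subst hq
      exact this.symm
  · intro e x hx
    simp only [Set.mem_ofPred_eq, rev_avoid2] at hx ⊢
    exact ml1_mem hab.symm (fun h => hcd ⟨h.2, h.1⟩) e x hx

/-! ### Second case: `aa = bb` with `a ≠ b`; complete system `aa → bb`, `abb → bba` -/

def m2 {α : Type} [DecidableEq α] (a b : α) : List α → List α
  | [] => [a]
  | [x] => if x = a then [b, b] else [a, x]
  | x :: y :: xs => if x = a then b :: b :: y :: xs else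
      if x = b ∧ y = b then b :: b :: m2 a b xs else a :: x :: y :: xs

def ml2 {α : Type} [DecidableEq α] (a b : α) (e : α) (x : List α) : List α :=
  if e = a then m2 a b x else e :: x

def s2 {α : Type} [DecidableEq α] (a b : α) : List α → List α
  | [] => [b, b]
  | x :: xs => if x = a ∨ x = b then x :: s2 a b xs else b :: b :: x :: xs

def ra2 {α : Type} [DecidableEq α] (a b : α) : List α → List α
  | [] => [a]
  | x :: xs => if x = a then s2 a b xs else a :: x :: xs

def rb2 {α : Type} [DecidableEq α] (a b : α) : List α → List α
  | x :: y :: xs => if x = b ∧ y = a then a :: s2 a b xs else b :: x :: y :: xs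
  | l => b :: l

def mr2 {α : Type} [DecidableEq α] (a b : α) (e : α) (x : List α) : List α :=
  if e = a then ra2 a b x else if e = b then rb2 a b x else e :: x

section
variable {α : Type} [DecidableEq α] {a b : α}

theorem m2_a (hab : a ≠ b) (x : List α) : m2 a b (a :: x) = b :: b :: x := by
  cases x <;> simp [m2]

theorem m2_bb (hab : a ≠ b) (x : List α) : m2 a b (b :: b :: x) = b :: b :: m2 a b x := by
  simp [m2, hab.symm]

theorem m2_b_ne (hab : a ≠ b) {y : α} (hy : y ≠ b) (x : List α) :
    m2 a b (b :: y :: x) = a :: b :: y :: x := by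
  simp [m2, hab.symm, hy]

theorem m2_b (hab : a ≠ b) : m2 a b [b] = [a, b] := by
  simp [m2, hab.symm]

theorem m2_ne {y : α} (hy : y ≠ a) (hy' : y ≠ b) (x : List α) :
    m2 a b (y :: x) = a :: y :: x := by
  cases x <;> simp [m2, hy, hy']

/-- irreducible words -/
def I2 (a b : α) (x : List α) : Prop := ¬ [a, a] <:+: x ∧ ¬ [a, b, b] <:+: x

theorem I2_cons (e : α) (x : List α) : I2 a b (e :: x) ↔
    I2 a b x ∧ ¬ (e = a ∧ ([a] <+: x ∨ [b, b] <+: x)) := by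
  unfold I2
  rw [List.infix_cons_iff, List.infix_cons_iff, List.cons_prefix_cons, List.cons_prefix_cons]
  rw [eq_comm (a := a) (b := e)]
  tauto

theorem I2_nil : I2 a b [] := by simp [I2]

theorem I2_ne {e : α} (he : e ≠ a) (x : List α) : I2 a b (e :: x) ↔ I2 a b x := by
  rw [I2_cons]; tauto

theorem m2_irr (hab : a ≠ b) (x : List α) (h : I2 a b (a :: x)) : m2 a b x = a :: x := by
  rw [I2_cons] at h
  obtain ⟨_, h⟩ := h
  push Not at h
  obtain ⟨h1, h2⟩ := h rfl
  rcases x with _ | ⟨y, x⟩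
  · rfl
  have hy : y ≠ a := by rintro rfl; simp at h1
  by_cases hyb : y = b
  · subst hyb
    rcases x with _ | ⟨z, x⟩
    · exact m2_b hab
    · exact m2_b_ne hab (by rintro rfl; simp at h2) x
  · exact m2_ne hy hyb x

/-- case analysis for `m2` -/
theorem m2_cases (hab : a ≠ b) (p : List α → Prop)
    (h1 : ∀ x, p (a :: x)) (h2 : ∀ x, p x → p (b :: b :: x))
    (h3 : ∀ x, ¬ [a] <+: x → ¬ [b, b] <+: x → p x) : ∀ x, p x := by
  intro x
  induction hn : x.length using Nat.strong_induction_on generalizing x with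
  | _ n ih =>
    subst hn
    by_cases ha : [a] <+: x
    · obtain ⟨t, rfl⟩ := ha
      exact h1 t
    by_cases hb : [b, b] <+: x
    · obtain ⟨t, rfl⟩ := hb
      exact h2 t (ih _ (by simp) t rfl)
    exact h3 x ha hb

theorem m2_mem (hab : a ≠ b) (x : List α) : I2 a b x → I2 a b (m2 a b x) := by
  refine m2_cases hab (fun x => I2 a b x → I2 a b (m2 a b x)) ?_ ?_ ?_ x
  · intro x h
    rw [m2_a hab, I2_ne hab.symm, I2_ne hab.symm]
    exact ((I2_cons _ _).1 h).1
  · intro x ih h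
    rw [I2_ne hab.symm, I2_ne hab.symm] at h
    rw [m2_bb hab, I2_ne hab.symm, I2_ne hab.symm]
    exact ih h
  · intro x h1 h2 h
    have : I2 a b (a :: x) := by rw [I2_cons]; tauto
    rw [m2_irr hab x this]
    exact this

theorem m2_m2 (hab : a ≠ b) (x : List α) : I2 a b x → m2 a b (m2 a b x) = b :: b :: x := by
  refine m2_cases hab (fun x => I2 a b x → m2 a b (m2 a b x) = b :: b :: x) ?_ ?_ ?_ x
  · intro x h
    rw [m2_a hab, m2_bb hab, m2_irr hab x h]
  · intro x ih h
    rw [I2_ne hab.symm, I2_ne hab.symm] at h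
    rw [m2_bb hab, m2_bb hab, ih h]
  · intro x h1 h2 h
    have : I2 a b (a :: x) := by rw [I2_cons]; tauto
    rw [m2_irr hab x this, m2_a hab]

theorem abb_eq {E : List α → List α → Prop} (hE : Cong E) (h : E [a, a] [b, b]) :
    E [a, b, b] [b, b, a] :=
  hE.trans (hE.symm (hE.cons h a)) (hE.app h [a])

theorem m2_eq (hab : a ≠ b) {E : List α → List α → Prop} (hE : Cong E) (h : E [a, a] [b, b])
    (x : List α) : I2 a b x → E (a :: x) (m2 a b x) := by
  refine m2_cases hab (fun x => I2 a b x → E (a :: x) (m2 a b x)) ?_ ?_ ?_ x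
  · intro x _
    rw [m2_a hab]
    exact hE.app h x
  · intro x ih hx
    rw [I2_ne hab.symm, I2_ne hab.symm] at hx
    rw [m2_bb hab]
    exact hE.trans (hE.app (abb_eq hE h) x) (hE.cons (hE.cons (ih hx) b) b)
  · intro x h1 h2 h
    have : I2 a b (a :: x) := by rw [I2_cons]; tauto
    rw [m2_irr hab x this]
    exact hE.refl _

theorem s2_eq {E : List α → List α → Prop} (hE : Cong E) (h : E [a, a] [b, b])
    (x : List α) : E (b :: b :: x) (s2 a b x) := by
  induction x with
  | nil => exact hE.refl _
  | cons y x ih =>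
    rw [s2]
    split_ifs with h1
    · rcases h1 with rfl | rfl
      · exact hE.trans (hE.app (hE.symm (abb_eq hE h)) x) (hE.cons ih _)
      · exact hE.cons ih _
    · exact hE.refl _

theorem mr2_eq {E : List α → List α → Prop} (hE : Cong E) (h : E [a, a] [b, b])
    (e : α) (x : List α) : E (e :: x) (mr2 a b e x) := by
  rw [mr2]
  split_ifs with h1 h2
  · subst h1
    rcases x with _ | ⟨y, x⟩
    · exact hE.refl _
    rw [ra2]
    split_ifs with h2
    · subst h2
      exact hE.trans (hE.app h x) (s2_eq hE h x)
    · exact hE.refl _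
  · subst h2
    rcases x with _ | ⟨y, _ | ⟨z, x⟩⟩
    · exact hE.refl _
    · exact hE.refl _
    rw [rb2]
    split_ifs with h2
    · obtain ⟨rfl, rfl⟩ := h2
      exact hE.trans (hE.app (hE.symm (abb_eq hE h)) x) (hE.cons (s2_eq hE h x) _)
    · exact hE.refl _
  · exact hE.refl _

/-- reversed irreducible words -/
def J2 (a b : α) (x : List α) : Prop := ¬ [a, a] <:+: x ∧ ¬ [b, b, a] <:+: x

theorem J2_cons (e : α) (x : List α) : J2 a b (e :: x) ↔
    J2 a b x ∧ ¬ (e = a ∧ [a] <+: x) ∧ ¬ (e = b ∧ [b, a] <+: x) := by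
  unfold J2
  rw [List.infix_cons_iff, List.infix_cons_iff, List.cons_prefix_cons, List.cons_prefix_cons]
  rw [eq_comm (a := a) (b := e), eq_comm (a := b) (b := e)]
  tauto

theorem s2_pre_a (hab : a ≠ b) (x : List α) : [a] <+: s2 a b x ↔ [a] <+: x := by
  rcases x with _ | ⟨y, x⟩
  · simp [s2, hab]
  rw [s2]
  split_ifs with h
  · simp
  · push Not at h
    simp [hab, h.1.symm]

theorem s2_pre_ba (hab : a ≠ b) (x : List α) : [b, a] <+: s2 a b x ↔ [b, a] <+: x := by
  rcases x with _ | ⟨y, x⟩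
  · simp [s2, hab]
  rw [s2]
  split_ifs with h
  · rw [List.cons_prefix_cons, List.cons_prefix_cons, s2_pre_a hab]
  · push Not at h
    simp [hab, h.2.symm]

theorem s2_mem (hab : a ≠ b) (x : List α) (h : J2 a b x) : J2 a b (s2 a b x) := by
  induction x with
  | nil => simp [s2, J2, List.infix_cons_iff, hab]
  | cons y x ih =>
    have h' := h
    rw [J2_cons] at h
    rw [s2]
    split_ifs with h1
    · rw [J2_cons, s2_pre_a hab, s2_pre_ba hab]
      exact ⟨ih h.1, h.2⟩
    · push Not at h1
      rw [J2_cons, J2_cons]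
      refine ⟨⟨h', ?_, ?_⟩, ?_, ?_⟩ <;> simp [hab, hab.symm, h1.1.symm, h1.2.symm]

theorem mr2_mem (hab : a ≠ b) (e : α) (x : List α) (h : J2 a b x) : J2 a b (mr2 a b e x) := by
  rw [mr2]
  split_ifs with h1 h2
  · subst h1
    rcases x with _ | ⟨y, x⟩
    · simp [ra2, J2, List.infix_cons_iff]
    rw [ra2]
    split_ifs with h2
    · exact s2_mem hab x ((J2_cons _ _).1 h).1
    · rw [J2_cons]
      refine ⟨h, ?_, ?_⟩
      · simp [Ne.symm h2]
      · simp [hab]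
  · subst h2
    rcases x with _ | ⟨y, _ | ⟨z, x⟩⟩
    · simp [rb2, J2, List.infix_cons_iff]
    · simp only [rb2, J2_cons] at h ⊢
      simp [h1] at h ⊢
      exact h
    rw [rb2]
    split_ifs with h2
    · obtain ⟨rfl, rfl⟩ := h2
      rw [J2_cons, J2_cons] at h
      rw [J2_cons, s2_pre_a hab]
      exact ⟨s2_mem hab x h.1.1, h.1.2.1, by simp [hab]⟩
    · rw [J2_cons]
      refine ⟨h, ?_, ?_⟩
      · simp [h1]
      · simp only [List.cons_prefix_cons, List.nil_prefix, and_true, true_and]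
        rintro ⟨rfl, rfl⟩
        exact h2 ⟨rfl, rfl⟩
  · rw [J2_cons]; tauto

theorem copy_delay [Finite α] (e : α) : DelayReg (fun x : List α => e :: x) := by
  refine ⟨Option (α × α), inferInstance, fun s x y => match s with
    | none => False
    | some (e, y0) => e :: x = y0 :: y, ?_, fun y0 => ⟨some (e, y0), fun x y => Iff.rfl⟩⟩
  rintro (_ | ⟨e, y0⟩) x y
  · exact ⟨none, fun _ _ => Iff.rfl⟩
  · by_cases h2 : e = y0
    · exact ⟨some (x, y), fun xs ys => by simp [h2]⟩
    · exact ⟨none, fun xs ys => by simp [h2]⟩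

theorem m2_delay [Finite α] (hab : a ≠ b) : DelayReg (m2 a b) := by
  refine ⟨Option ((α × α) ⊕ α ⊕ (α × α)), inferInstance, fun s x y => match s with
    | none => False
    | some (Sum.inl (e, y0)) => e :: x = y0 :: y
    | some (Sum.inr (Sum.inl y0)) => m2 a b x = y0 :: y
    | some (Sum.inr (Sum.inr (p, q))) => m2 a b (b :: x) = p :: q :: y,
    ?_, fun y0 => ⟨some (Sum.inr (Sum.inl y0)), fun x y => Iff.rfl⟩⟩
  rintro (_ | ⟨e, y0⟩ | y0 | ⟨p, q⟩) x y
  · exact ⟨none, fun _ _ => Iff.rfl⟩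
  · by_cases h2 : e = y0
    · exact ⟨some (Sum.inl (x, y)), fun xs ys => by simp [h2]⟩
    · exact ⟨none, fun xs ys => by simp [h2]⟩
  · by_cases hx : x = b
    · exact ⟨some (Sum.inr (Sum.inr (y0, y))), fun xs ys => by rw [hx]⟩
    by_cases hx' : x = a
    · subst hx'
      by_cases h2 : b = y0
      · exact ⟨some (Sum.inl (b, y)), fun xs ys => by
          simp only [m2_a hab, List.cons.injEq]
          tauto⟩
      · exact ⟨none, fun xs ys => by simp [m2_a hab, h2]⟩
    · by_cases h2 : a = y0
      · exact ⟨some (Sum.inl (x, y)), fun xs ys => by simp only [m2_ne hx' hx]; simp [h2]⟩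
      · exact ⟨none, fun xs ys => by simp only [m2_ne hx' hx]; simp [h2]⟩
  · by_cases hx : x = b
    · subst hx
      by_cases h2 : x = p ∧ x = q
      · exact ⟨some (Sum.inr (Sum.inl y)), fun xs ys => by
          simp only [m2_bb hab, List.cons.injEq]
          tauto⟩
      · exact ⟨none, fun xs ys => by
          simp only [m2_bb hab, List.cons.injEq, iff_false]
          tauto⟩
    · by_cases h2 : a = p ∧ b = q
      · exact ⟨some (Sum.inl (x, y)), fun xs ys => by
          simp only [m2_b_ne hab hx, List.cons.injEq]
          tauto⟩
      · exact ⟨none, fun xs ys => by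
          simp only [m2_b_ne hab hx, List.cons.injEq, iff_false]
          tauto⟩

/-- common transition relation for the right multiplication transducers -/
def Q2 (a b : α) : Option (((α × α) ⊕ (α × α)) ⊕ (α ⊕ α) ⊕ (α × α)) → List α → List α → Prop
  | none, _, _ => False
  | some (Sum.inl (Sum.inl (e, y0))), x, y => e :: x = y0 :: y
  | some (Sum.inl (Sum.inr (p, q))), x, y => s2 a b x = p :: q :: y
  | some (Sum.inr (Sum.inl (Sum.inl y0))), x, y => ra2 a b x = y0 :: y
  | some (Sum.inr (Sum.inl (Sum.inr y0))), x, y => rb2 a b x = y0 :: y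
  | some (Sum.inr (Sum.inr (p, q))), x, y => rb2 a b (b :: x) = p :: q :: y

theorem Q2_step (hab : a ≠ b) (s) (x y : α) : ∃ s', ∀ xs ys,
    Q2 a b s (x :: xs) (y :: ys) ↔ Q2 a b s' xs ys := by
  rcases s with _ | (⟨e, y0⟩ | ⟨p, q⟩) | (y0 | y0) | ⟨p, q⟩
  · exact ⟨none, fun _ _ => Iff.rfl⟩
  · by_cases h2 : e = y0
    · exact ⟨some (Sum.inl (Sum.inl (x, y))), fun xs ys => by simp [Q2, h2]⟩
    · exact ⟨none, fun xs ys => by simp [Q2, h2]⟩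
  · by_cases hx : x = a ∨ x = b
    · by_cases h2 : x = p
      · exact ⟨some (Sum.inl (Sum.inr (q, y))), fun xs ys => by
          simp only [Q2, s2, if_pos hx, List.cons.injEq]
          tauto⟩
      · exact ⟨none, fun xs ys => by
          simp only [Q2, s2, if_pos hx, List.cons.injEq, h2, false_and]⟩
    · by_cases h2 : b = p ∧ b = q
      · exact ⟨some (Sum.inl (Sum.inl (x, y))), fun xs ys => by
          simp only [Q2, s2, if_neg hx, List.cons.injEq]
          tauto⟩
      · exact ⟨none, fun xs ys => by
          simp only [Q2, s2, if_neg hx, List.cons.injEq, iff_false]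
          tauto⟩
  · by_cases hx : x = a
    · exact ⟨some (Sum.inl (Sum.inr (y0, y))), fun xs ys => by
          simp only [Q2, ra2, if_pos hx]⟩
    · by_cases h2 : a = y0
      · exact ⟨some (Sum.inl (Sum.inl (x, y))), fun xs ys => by
          simp only [Q2, ra2, if_neg hx, List.cons.injEq]
          tauto⟩
      · exact ⟨none, fun xs ys => by
          simp only [Q2, ra2, if_neg hx, List.cons.injEq, h2, false_and]⟩
  · by_cases hx : x = b
    · exact ⟨some (Sum.inr (Sum.inr (y0, y))), fun xs ys => by
          simp only [Q2, hx]⟩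
    · have e : ∀ xs, rb2 a b (x :: xs) = b :: x :: xs := by
        intro xs
        cases xs <;> simp [rb2, hx]
      by_cases h2 : b = y0
      · exact ⟨some (Sum.inl (Sum.inl (x, y))), fun xs ys => by
          simp only [Q2, e, List.cons.injEq]
          tauto⟩
      · exact ⟨none, fun xs ys => by
          simp only [Q2, e, List.cons.injEq, h2, false_and]⟩
  · by_cases hx : x = a
    · by_cases h2 : a = p
      · exact ⟨some (Sum.inl (Sum.inr (q, y))), fun xs ys => by
          simp only [Q2, rb2, hx, true_and, if_true, List.cons.injEq, h2]⟩
      · exact ⟨none, fun xs ys => by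
          simp only [Q2, rb2, hx, true_and, if_true, List.cons.injEq, h2, false_and]⟩
    · by_cases h2 : b = p ∧ b = q
      · exact ⟨some (Sum.inl (Sum.inl (x, y))), fun xs ys => by
          simp only [Q2, rb2, hx, and_false, if_false, List.cons.injEq]
          tauto⟩
      · exact ⟨none, fun xs ys => by
          simp only [Q2, rb2, hx, and_false, if_false, List.cons.injEq, iff_false]
          tauto⟩

theorem mr2_delay [Finite α] (hab : a ≠ b) (e : α) : DelayReg (mr2 a b e) := by
  by_cases h1 : e = a
  · have : mr2 a b e = ra2 a b := by funext x; simp [mr2, h1]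
    rw [this]
    exact ⟨_, inferInstance, Q2 a b, Q2_step hab,
      fun y0 => ⟨some (Sum.inr (Sum.inl (Sum.inl y0))), fun _ _ => Iff.rfl⟩⟩
  by_cases h2 : e = b
  · have : mr2 a b e = rb2 a b := by funext x; simp [mr2, h2, hab.symm]
    rw [this]
    exact ⟨_, inferInstance, Q2 a b, Q2_step hab,
      fun y0 => ⟨some (Sum.inr (Sum.inl (Sum.inr y0))), fun _ _ => Iff.rfl⟩⟩
  have : mr2 a b e = fun x => e :: x := by funext x; simp [mr2, h1, h2]
  rw [this]
  exact copy_delay e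

theorem ml2_delay [Finite α] (hab : a ≠ b) (e : α) : DelayReg (ml2 a b e) := by
  by_cases h1 : e = a
  · have : ml2 a b e = m2 a b := by funext x; simp [ml2, h1]
    rw [this]
    exact m2_delay hab
  have : ml2 a b e = fun x => e :: x := by funext x; simp [ml2, h1]
  rw [this]
  exact copy_delay e

theorem rev_I2 (x : List α) : I2 a b x.reverse ↔ J2 a b x := by
  have h1 := List.reverse_infix (l₁ := [a, a]) (l₂ := x)
  have h2 := List.reverse_infix (l₁ := [b, b, a]) (l₂ := x)
  simp only [List.reverse_cons, List.reverse_nil, List.nil_append, List.cons_append] at h1 h2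
  rw [I2, J2, h1, h2]

end

theorem case2 {α : Type} [Fintype α] (R : Set (List α × List α)) (a b : α) (hab : a ≠ b)
    (hR : R = {([a, a], [b, b])}) :
    MonBiautomatic R ∧ MonPrefixAutomatic R := by
  classical
  subst hR
  have hbase : WordEq {([a, a], [b, b])} [a, a] [b, b] := WordEq.base (Set.mem_singleton _)
  refine build _ {x | I2 a b x} (ml2 a b) (mr2 a b) ?_ ?_ I2_nil
    (isReg_congr (isReg_inter (avoid2 a a) (avoid3 a b b)) (fun w => Iff.rfl)) ?_ ?_ ?_ ?_ ?_
    (fun e x _ => mr2_eq (cong_rev _) hbase e x)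
    (ml2_delay hab) (mr2_delay hab)
  · simp
  · intro x hx y hy
    exact ⟨fun h => hx.1 (h.trans hy), fun h => hx.2 (h.trans hy)⟩
  · intro e x hx
    show I2 a b (ml2 a b e x)
    rw [ml2]
    split_ifs with h
    · exact m2_mem hab x hx
    · exact (I2_ne h x).2 hx
  · intro e x hx
    rw [ml2]
    split_ifs with h
    · subst h
      exact m2_eq hab (cong_word _) hbase x hx
    · exact WordEq.rfl' _
  · intro e x hx
    rw [ml2]
    split_ifs with h
    · subst h
      exact m2_irr hab x hx
    · rfl
  · intro q hq x hx
    rw [Set.mem_singleton_iff] at hq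
    subst hq
    simp only [List.foldr_cons, List.foldr_nil, ml2, if_true, if_neg hab.symm]
    exact m2_m2 hab x hx
  · intro e x hx
    simp only [Set.mem_ofPred_eq, rev_I2] at hx ⊢
    exact mr2_mem hab e x hx

/-- a one-relator monoid `S = sgp⟨α ∣ u = v⟩` with
`|u| = |v| = 2` and `u ≠ v` is biautomatic and prefix-automatic. -/
theorem statement_13 {α : Type} [Fintype α] (u v : List α)
    (hu : u.length = 2) (hv : v.length = 2) (huv : u ≠ v)
    (R : Set (List α × List α)) (hRdef : R = {(u, v)}) :
    MonBiautomatic R ∧ MonPrefixAutomatic R := by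
  subst hRdef
  obtain ⟨a, b, rfl⟩ := List.length_eq_two.1 hu
  obtain ⟨c, d, rfl⟩ := List.length_eq_two.1 hv
  by_cases hab : a = b
  · by_cases hcd : c = d
    · subst hab hcd
      exact case2 _ a c (by rintro rfl; exact huv rfl) rfl
    · exact case1 _ c d a b hcd (by rintro ⟨rfl, rfl⟩; exact huv rfl) (Or.inr rfl)
  · exact case1 _ a b c d hab (by rintro ⟨rfl, rfl⟩; exact huv rfl) (Or.inl rfl)
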